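/- arXiv:2208.04279 — 6 statements merged into one kernel-verified Lean document; each statement's English description precedes it below -/
import Mathlib

section
/- Let f : Fin k → MvPolynomial (Fin m) ℂ be polynomials and p : Fin k → ℂ. Write F : (Fin m → ℂ) → (Fin k → ℂ) for the polynomial map F(x) i = eval x (f i), and let Φ : ℂ × (Fin m → ℂ) → (Fin k → ℂ) be Φ(z, x) i = eval x (f i) − z * p i. Assume the total space is smooth: for every (z, x) with Φ(z, x) = 0, the Fréchet derivative fderiv ℂ Φ (z, x) is surjective onto Fin k → ℂ. Then the set of singular values S = { z : ℂ | ∃ x : Fin m → ℂ, (∀ i, eval x (f i) = z * p i) ∧ ¬ Function.Surjective (fderiv ℂ F x) } is finite. -/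
open MvPolynomial

open KaehlerDifferential in
/-- In characteristic zero, an element of a finitely generated field extension whose differential
vanishes is algebraic over the base field. -/
theorem isAlgebraic_of_kaehlerDifferential_D_eq_zero {k K : Type*} [Field k] [CharZero k]
    [Field K] [Algebra k K] [Algebra.EssFiniteType k K] {z : K} (hz : D k K z = 0) :
    IsAlgebraic k z := by
  by_contra htr
  have hinj : Function.Injective (Polynomial.aeval z : Polynomial k →ₐ[k] K) :=
    transcendental_iff_injective.mp htr
  let : Algebra (Polynomial k) K := (Polynomial.aeval z : Polynomial k →ₐ[k] K).toAlgebra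
  have : IsScalarTower k (Polynomial k) K :=
    .of_algebraMap_eq fun a ↦ ((Polynomial.aeval z : Polynomial k →ₐ[k] K).commutes a).symm
  have : FaithfulSMul (Polynomial k) K := (faithfulSMul_iff_algebraMap_injective _ _).mpr hinj
  let E := FractionRing (Polynomial k)
  let : Algebra E K := FractionRing.liftAlgebra (Polynomial k) K
  have : IsScalarTower (Polynomial k) E K := FractionRing.isScalarTower_liftAlgebra _ _
  have : IsScalarTower k E K := .to₁₃₄ k (Polynomial k) E K
  have : CharZero E := charZero_of_injective_algebraMap (algebraMap k E).injective
  have : Algebra.EssFiniteType E K := .of_comp k E K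
  have : Algebra.FormallySmooth (Polynomial k) E :=
    .of_isLocalization (nonZeroDivisors (Polynomial k))
  have : Algebra.FormallySmooth (Polynomial k) K := .comp _ E K
  have hbase : Function.Injective (mapBaseChange k (Polynomial k) K) := by
    rw [injective_iff_map_eq_zero]
    intro a ha
    obtain ⟨b, rfl⟩ := (Algebra.H1Cotangent.exact_δ_mapBaseChange k (Polynomial k) K a).mp ha
    rw [Subsingleton.elim b 0, map_zero]
  have hX : (1 : K) ⊗ₜ[Polynomial k] D k (Polynomial k) Polynomial.X = 0 := by
    apply hbase
    have : algebraMap (Polynomial k) K Polynomial.X = z := Polynomial.aeval_X z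
    rw [mapBaseChange_tmul, map_D, this, hz, smul_zero, map_zero]
  have := congrArg (TensorProduct.rid (Polynomial k) K ∘
    (polynomialEquiv k).toLinearMap.lTensor K) hX
  simp [polynomialEquiv_D] at this

/-- On an integral domain of finite type over an algebraically closed field of characteristic zero,
a function with vanishing differential is constant. -/
theorem mem_range_algebraMap_of_kaehlerDifferential_D_eq_zero {k A : Type*} [Field k] [CharZero k]
    [IsAlgClosed k] [CommRing A] [IsDomain A] [Algebra k A] [Algebra.FiniteType k A] {z : A}
    (hz : KaehlerDifferential.D k A z = 0) : z ∈ (algebraMap k A).range := by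
  let K := FractionRing A
  have : Algebra.EssFiniteType A K := .of_isLocalization _ (nonZeroDivisors A)
  have : Algebra.EssFiniteType k K := .comp k A K
  have hK : KaehlerDifferential.D k K (algebraMap A K z) = 0 := by
    rw [← KaehlerDifferential.map_D k k, hz, map_zero]
  have hint := (isAlgebraic_of_kaehlerDifferential_D_eq_zero hK).isIntegral
  obtain ⟨c, hc⟩ := minpoly.mem_range_of_degree_eq_one k _
    (IsAlgClosed.degree_eq_one_of_irreducible k (minpoly.irreducible hint))
  refine ⟨c, IsFractionRing.injective A K ?_⟩
  rw [← IsScalarTower.algebraMap_apply, hc]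

/-- A function with vanishing differential on a scheme of finite type over an algebraically closed
field of characteristic zero takes finitely many values. -/
theorem finite_range_algHom_apply_of_kaehlerDifferential_D_eq_zero {k A : Type*} [Field k]
    [CharZero k] [IsAlgClosed k] [CommRing A] [Algebra k A] [Algebra.FiniteType k A] {z : A}
    (hz : KaehlerDifferential.D k A z = 0) : (Set.range fun φ : A →ₐ[k] k ↦ φ z).Finite := by
  have : IsNoetherianRing A := Algebra.FiniteType.isNoetherianRing k A
  have hconst (P : Ideal A) (hP : P ∈ minimalPrimes A) : ∃ c : k, algebraMap k A c - z ∈ P := by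
    have : P.IsPrime := hP.1.1
    have hzP : KaehlerDifferential.D k (A ⧸ P) (algebraMap A (A ⧸ P) z) = 0 := by
      rw [← KaehlerDifferential.map_D k k, hz, map_zero]
    obtain ⟨c, hc⟩ := mem_range_algebraMap_of_kaehlerDifferential_D_eq_zero hzP
    exact ⟨c, Ideal.Quotient.eq.mp hc⟩
  choose! c hc using hconst
  refine ((minimalPrimes.finite_of_isNoetherianRing A).image c).subset ?_
  rintro _ ⟨φ, rfl⟩
  have := RingHom.ker_isPrime (φ : A →+* k)
  obtain ⟨P, hP, hle⟩ := Ideal.exists_minimalPrimes_le (bot_le : ⊥ ≤ RingHom.ker (φ : A →+* k))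
  refine ⟨P, hP, ?_⟩
  have := hle (hc P hP)
  simpa [RingHom.mem_ker, sub_eq_zero] using this

/-- The chain rule for a derivation applied to a polynomial expression. -/
theorem Derivation.map_aeval_mvPolynomial {R A M σ : Type*} [CommRing R] [CommRing A] [Algebra R A]
    [AddCommGroup M] [Module R M] [Module A M] [IsScalarTower R A M] [Fintype σ]
    (d : Derivation R A M) (x : σ → A) (q : MvPolynomial σ R) :
    d (aeval x q) = ∑ j, aeval x (pderiv j q) • d (x j) := by
  classical
  induction q using MvPolynomial.induction_on with
  | C a => simp
  | add q r hq hr => simp [hq, hr, add_smul, Finset.sum_add_distrib]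
  | mul_X q i hq =>
    simp only [map_mul, aeval_X, Derivation.leibniz, hq, pderiv_X, map_add, add_smul,
      smul_eq_mul, Finset.sum_add_distrib, Finset.smul_sum, smul_smul]
    simp [Pi.single_apply, apply_ite, ite_smul]

/-- The derivative of a polynomial function in terms of its partial derivatives. -/
theorem MvPolynomial.hasFDerivAt_eval {𝕜 σ : Type*} [NontriviallyNormedField 𝕜] [Fintype σ]
    (q : MvPolynomial σ 𝕜) (x : σ → 𝕜) :
    HasFDerivAt (fun y : σ → 𝕜 ↦ eval y q)
      (∑ j, eval x (pderiv j q) • ContinuousLinearMap.proj (R := 𝕜) (φ := fun _ ↦ 𝕜) j) x := by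
  classical
  induction q using MvPolynomial.induction_on with
  | C a =>
    convert! hasFDerivAt_const (𝕜 := 𝕜) a x using 1
    · simp
    · ext v
      simp
  | add q r hq hr =>
    convert! hq.fun_add hr using 1
    · simp
    · ext v
      simp [add_mul, Finset.sum_add_distrib]
  | mul_X q i hq =>
    simp only [map_mul, eval_X]
    convert! hq.mul (hasFDerivAt_apply i x) using 1
    ext v
    simp [pderiv_X, Pi.single_apply, add_mul, Finset.sum_add_distrib, Finset.mul_sum, apply_ite,
      mul_assoc]

/-- If `(v, c) ↦ L v - c • p` is surjective and `L` is not, then some linear functional vanishes on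
the range of `L` and is normalized at `p`. -/
theorem LinearMap.exists_dual_comp_eq_zero_of_not_surjective {K V W : Type*} [Field K]
    [AddCommGroup V] [Module K V] [AddCommGroup W] [Module K W] {L : V →ₗ[K] W} {p : W}
    (hsurj : ∀ w, ∃ (c : K) (v : V), L v - c • p = w) (hL : ¬ Function.Surjective L) :
    ∃ l : Module.Dual K W, (∀ v, l (L v) = 0) ∧ l p = 1 := by
  obtain ⟨l, hl0, hl⟩ := Submodule.exists_le_ker_of_lt_top (LinearMap.range L)
    (lt_top_iff_ne_top.mpr fun h ↦ hL (LinearMap.range_eq_top.mp h))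
  have hLv (v : V) : l (L v) = 0 := hl ⟨v, rfl⟩
  have hp : l p ≠ 0 := by
    intro hp
    refine hl0 (LinearMap.ext fun w ↦ ?_)
    obtain ⟨c, v, rfl⟩ := hsurj w
    simp [hLv, hp]
  exact ⟨(l p)⁻¹ • l, fun v ↦ by simp [hLv], by simp [hp]⟩

/-- If `f i x = p i * z`, `∑ i, l i * ∂ⱼ (f i) x = 0` and `∑ i, l i * p i = 1` hold in an algebra,
then the differential of `z` vanishes. -/
theorem MvPolynomial.kaehlerDifferential_D_eq_zero_of_critical {R A σ ι : Type*} [CommRing R]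
    [CommRing A] [Algebra R A] [Fintype σ] [Fintype ι] {f : ι → MvPolynomial σ R} {p : ι → R}
    {x : σ → A} {l : ι → A} {z : A} (hfib : ∀ i, aeval x (f i) = algebraMap R A (p i) * z)
    (hcrit : ∀ j, ∑ i, l i * aeval x (pderiv j (f i)) = 0)
    (hnorm : ∑ i, l i * algebraMap R A (p i) = 1) : KaehlerDifferential.D R A z = 0 := by
  set d := KaehlerDifferential.D R A
  have hd (i : ι) : ∑ j, aeval x (pderiv j (f i)) • d (x j) = algebraMap R A (p i) • d z := by
    rw [← d.map_aeval_mvPolynomial, hfib, ← Algebra.smul_def, d.map_smul, algebraMap_smul]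
  calc d z = (∑ i, l i * algebraMap R A (p i)) • d z := by rw [hnorm, one_smul]
    _ = ∑ j, (∑ i, l i * aeval x (pderiv j (f i))) • d (x j) := by
      simp only [Finset.sum_smul, mul_smul, ← hd, Finset.smul_sum]
      exact Finset.sum_comm
    _ = 0 := by simp only [hcrit, zero_smul, Finset.sum_const_zero]

/-- A family of solutions `(x, l, z)` of `f i x = z * p i`, `∑ i, l i * ∂ⱼ (f i) x = 0`,
`∑ i, l i * p i = 1` attains finitely many values of `z`. -/
theorem MvPolynomial.finite_setOf_critical_value {K σ ι : Type*} [Field K] [CharZero K]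
    [IsAlgClosed K] [Fintype σ] [Fintype ι] (f : ι → MvPolynomial σ K) (p : ι → K) :
    {z : K | ∃ (x : σ → K) (l : ι → K), (∀ i, eval x (f i) = z * p i) ∧
      (∀ j, ∑ i, l i * eval x (pderiv j (f i)) = 0) ∧ ∑ i, l i * p i = 1}.Finite := by
  let B := MvPolynomial (Option (σ ⊕ ι)) K
  let X' (j : σ) : B := X (some (.inl j))
  let L' (i : ι) : B := X (some (.inr i))
  let Z' : B := X none
  let I : Ideal B := Ideal.span (Set.range (fun i ↦ aeval X' (f i) - Z' * C (p i)) ∪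
    Set.range (fun j ↦ ∑ i, L' i * aeval X' (pderiv j (f i))) ∪ {∑ i, L' i * C (p i) - 1})
  let π : B →ₐ[K] B ⧸ I := Ideal.Quotient.mkₐ K I
  have hπ {b : B} (hb : b ∈ I) : π b = 0 := Ideal.Quotient.eq_zero_iff_mem.mpr hb
  have hcomp (q : MvPolynomial σ K) : π (aeval X' q) = aeval (fun j ↦ π (X' j)) q := by
    rw [← AlgHom.comp_apply, comp_aeval]
  have hfib (i : ι) : aeval (fun j ↦ π (X' j)) (f i) = algebraMap K _ (p i) * π Z' := by
    have := hπ (Ideal.subset_span (.inl (.inl ⟨i, rfl⟩)))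
    rw [map_sub, sub_eq_zero, hcomp, map_mul, mul_comm] at this
    exact this
  have hcrit (j : σ) : ∑ i, π (L' i) * aeval (fun j ↦ π (X' j)) (pderiv j (f i)) = 0 := by
    have := hπ (Ideal.subset_span (.inl (.inr ⟨j, rfl⟩)))
    simpa only [map_sum, map_mul, hcomp] using this
  have hnorm : ∑ i, π (L' i) * algebraMap K _ (p i) = 1 := by
    have := hπ (Ideal.subset_span (.inr rfl))
    simp only [map_sub, map_sum, map_mul, map_one, sub_eq_zero] at this
    exact this
  have hD : KaehlerDifferential.D K (B ⧸ I) (π Z') = 0 :=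
    kaehlerDifferential_D_eq_zero_of_critical hfib hcrit hnorm
  refine (finite_range_algHom_apply_of_kaehlerDifferential_D_eq_zero hD).subset ?_
  rintro z ⟨x, l, hx, hl, hp⟩
  let φ : B →ₐ[K] K := aeval fun o ↦ o.elim z (Sum.elim x l)
  have hφx (j : σ) : φ (X' j) = x j := aeval_X _ _
  have hφl (i : ι) : φ (L' i) = l i := aeval_X _ _
  have hφz : φ Z' = z := aeval_X _ _
  have hφC (c : K) : φ (C c) = c := aeval_C _ _
  have hφ (q : MvPolynomial σ K) : φ (aeval X' q) = eval x q := by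
    rw [← AlgHom.comp_apply, comp_aeval, ← coe_aeval_eq_eval]
    simp only [hφx]
    rfl
  have hI : I ≤ RingHom.ker φ := by
    rw [Ideal.span_le]
    rintro _ ((⟨i, rfl⟩ | ⟨j, rfl⟩) | rfl) <;>
      simp only [SetLike.mem_coe, RingHom.mem_ker, map_sub, map_mul, map_sum, map_one, hφ, hφl,
        hφz, hφC, hx, hl, hp, sub_self]
  exact ⟨Ideal.Quotient.liftₐ I φ fun b hb ↦ hI hb, hφz⟩

/-- If the total space `𝒳 = {(z,x) : f i x = z * p i for all i}` is smooth
(the derivative of `Φ(z,x) = (f i x - z * p i)_i` is surjective at every zero of `Φ`),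
then the set of `z ∈ ℂ` over which the fiber `{x : f i x = z * p i}` is singular
is finite. -/
theorem stmt_1 (k m : ℕ) (f : Fin k → MvPolynomial (Fin m) ℂ) (p : Fin k → ℂ)
    (F : (Fin m → ℂ) → (Fin k → ℂ))
    (hF : ∀ x i, F x i = MvPolynomial.eval x (f i))
    (Φ : ℂ × (Fin m → ℂ) → (Fin k → ℂ))
    (hΦ : ∀ zx : ℂ × (Fin m → ℂ), ∀ i, Φ zx i = MvPolynomial.eval zx.2 (f i) - zx.1 * p i)
    (hsmooth : ∀ zx : ℂ × (Fin m → ℂ), Φ zx = 0 → Function.Surjective (fderiv ℂ Φ zx)) :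
    Set.Finite { z : ℂ | ∃ x : Fin m → ℂ,
      (∀ i, MvPolynomial.eval x (f i) = z * p i) ∧
      ¬ Function.Surjective (fderiv ℂ F x) } := by
  refine (MvPolynomial.finite_setOf_critical_value f p).subset ?_
  rintro z ⟨x, hx, hns⟩
  have hFx : HasFDerivAt F (ContinuousLinearMap.pi fun i ↦ ∑ j, eval x (pderiv j (f i)) •
      ContinuousLinearMap.proj (R := ℂ) (φ := fun _ ↦ ℂ) j) x := by
    refine hasFDerivAt_pi.mpr fun i ↦ ?_
    simpa only [hF] using (f i).hasFDerivAt_eval x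
  have hΦx : HasFDerivAt Φ ((fderiv ℂ F x).comp (.snd ℂ ℂ (Fin m → ℂ)) -
      (ContinuousLinearMap.fst ℂ ℂ (Fin m → ℂ)).smulRight p) (z, x) := by
    have hΦF : Φ = fun zx ↦ F zx.2 - zx.1 • p := by
      ext zx i
      simp [hΦ, hF]
    rw [hΦF]
    exact (hFx.differentiableAt.hasFDerivAt.comp (z, x) hasFDerivAt_snd).sub
      (hasFDerivAt_fst.smul_const p)
  have hsurj := hsmooth (z, x) (by ext i; simp [hΦ, hx])
  rw [hΦx.fderiv] at hsurj
  obtain ⟨l, hl, hlp⟩ := LinearMap.exists_dual_comp_eq_zero_of_not_surjective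
    (L := (fderiv ℂ F x).toLinearMap) (p := p)
    (fun w ↦ (hsurj w).elim fun v hv ↦ ⟨v.1, v.2, hv⟩) hns
  refine ⟨x, fun i ↦ l fun j ↦ if i = j then 1 else 0, hx, fun j ↦ ?_, ?_⟩
  · have hlj := hl (Pi.single j 1)
    rw [LinearMap.pi_apply_eq_sum_univ l, hFx.fderiv] at hlj
    simpa [Pi.single_apply, mul_comm] using hlj
  · rw [LinearMap.pi_apply_eq_sum_univ l p] at hlp
    simpa only [smul_eq_mul, mul_comm] using hlp
end

section
/- Let f₁, f₂ be the polynomial functions on ℂ⁵ given by f₁(z₁,…,z₅) = z₁² + z₂z₃ + z₄³ and f₂(z₁,…,z₅) = z₁z₄² + z₂² + z₃²z₄ + z₅³. Then for every t₁ ∈ ℂ, the fiber { x ∈ ℂ⁵ : f₁(x) = t₁ and f₂(x) = 0 } is singular; that is, there exists x ∈ ℂ⁵ with f₁(x) = t₁, f₂(x) = 0, and the Fréchet derivative at x of the map x ↦ (f₁(x), f₂(x)) : ℂ⁵ → ℂ² is not surjective. -/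
/-- For `f₁(z) = z₁² + z₂z₃ + z₄³` and `f₂(z) = z₁z₄² + z₂² + z₃²z₄ + z₅³` on `ℂ⁵`,
every fiber `{f₁ = t₁, f₂ = 0}` is singular: it contains a point at which the
derivative of `(f₁, f₂) : ℂ⁵ → ℂ²` is not surjective. -/
theorem stmt_2 :
    ∀ t₁ : ℂ, ∃ x : Fin 5 → ℂ,
      (x 0) ^ 2 + x 1 * x 2 + (x 3) ^ 3 = t₁ ∧
      x 0 * (x 3) ^ 2 + (x 1) ^ 2 + (x 2) ^ 2 * x 3 + (x 4) ^ 3 = 0 ∧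
      ¬ Function.Surjective (fderiv ℂ (fun y : Fin 5 → ℂ =>
        ((y 0) ^ 2 + y 1 * y 2 + (y 3) ^ 3,
          y 0 * (y 3) ^ 2 + (y 1) ^ 2 + (y 2) ^ 2 * y 3 + (y 4) ^ 3)) x) := by
  intro t
  obtain ⟨s, rfl⟩ := IsAlgClosed.exists_pow_nat_eq t two_pos
  refine ⟨Pi.single 0 s, by simp, by simp, fun hsurj => ?_⟩
  set x : Fin 5 → ℂ := Pi.single 0 s with hx
  have hp (i : Fin 5) : HasFDerivAt (fun y : Fin 5 → ℂ => y i)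
      (ContinuousLinearMap.proj (R := ℂ) (φ := fun _ : Fin 5 => ℂ) i) x :=
    hasFDerivAt_apply i x
  have h₁ := (((hp 0).pow 2).add ((hp 1).mul (hp 2))).add ((hp 3).pow 3)
  have h₂ := ((((hp 0).mul ((hp 3).pow 2)).add ((hp 1).pow 2)).add
    (((hp 2).pow 2).mul (hp 3))).add ((hp 4).pow 3)
  obtain ⟨v, hv⟩ := hsurj (0, 1)
  erw [(h₁.prodMk h₂).fderiv] at hv
  simpa [hx] using congrArg Prod.snd hv
end

section
/- Let m ≥ 1 and let w : Fin m → ℝ satisfy 1 ≤ w i for all i. For every x : Fin m → ℂ with x ≠ 0 there is a unique s > 0 such that ∑ i, s^(2 * w i) * ‖x i‖² = 1 (real powers). Moreover this unique scaling parameter is homogeneous: if s(x) denotes the unique such s, then for every t > 0 one has s(fun i => (t^(w i) : ℂ) * x i) = s(x) / t. -/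
open Finset in
/-- The sum `∑ i, s ^ (2 w i) ‖x i‖²` is strictly increasing in `s ≥ 0` when `x ≠ 0`. -/
theorem strictMonoOn_sum_rpow_mul_norm_sq {ι : Type*} [Fintype ι] {w : ι → ℝ}
    (hw : ∀ i, 0 < w i) {x : ι → ℂ} (hx : x ≠ 0) :
    StrictMonoOn (fun s : ℝ => ∑ i, s ^ (2 * w i) * ‖x i‖ ^ 2) (Set.Ici 0) := by
  intro a ha b _ hab
  have ha : 0 ≤ a := ha
  obtain ⟨j, hj⟩ := Function.ne_iff.mp hx
  have hlt (i : ι) : a ^ (2 * w i) < b ^ (2 * w i) :=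
    Real.rpow_lt_rpow ha hab (mul_pos two_pos (hw i))
  have hj : 0 < ‖x j‖ ^ 2 := pow_pos (norm_pos_iff.mpr hj) 2
  exact sum_lt_sum (fun i _ => mul_le_mul_of_nonneg_right (hlt i).le (sq_nonneg _))
    ⟨j, mem_univ j, mul_lt_mul_of_pos_right (hlt j) hj⟩

open Finset in
/-- Every `x ≠ 0` can be scaled to the unit sphere by some `s > 0`. -/
theorem exists_pos_sum_rpow_mul_norm_sq_eq_one {ι : Type*} [Fintype ι] {w : ι → ℝ}
    (hw : ∀ i, 0 < w i) {x : ι → ℂ} (hx : x ≠ 0) :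
    ∃ s : ℝ, 0 < s ∧ ∑ i, s ^ (2 * w i) * ‖x i‖ ^ 2 = 1 := by
  obtain ⟨j, hj⟩ := Function.ne_iff.mp hx
  have hj : 0 < ‖x j‖ := norm_pos_iff.mpr hj
  set f : ℝ → ℝ := fun s => ∑ i, s ^ (2 * w i) * ‖x i‖ ^ 2 with hf
  have hcont : Continuous f := continuous_finsetSum _ fun i _ =>
    (Real.continuous_rpow_const (mul_pos two_pos (hw i)).le).mul continuous_const
  have hzero : f 0 = 0 := sum_eq_zero fun i _ => by
    rw [Real.zero_rpow (mul_pos two_pos (hw i)).ne', zero_mul]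
  set b : ℝ := ‖x j‖ ^ (-(w j)⁻¹) with hb
  have hb0 : 0 ≤ b := Real.rpow_nonneg hj.le _
  have hbj : b ^ (2 * w j) * ‖x j‖ ^ 2 = 1 := by
    have hexp : -(w j)⁻¹ * (2 * w j) = -2 := by field_simp [(hw j).ne']
    rw [hb, ← Real.rpow_mul hj.le, hexp, ← Real.rpow_natCast, ← Real.rpow_add hj]
    norm_num
  have hone : 1 ≤ f b := hbj.symm.le.trans <|
    single_le_sum (f := fun i => b ^ (2 * w i) * ‖x i‖ ^ 2)
      (fun i _ => mul_nonneg (Real.rpow_nonneg hb0 _) (sq_nonneg _)) (mem_univ j)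
  obtain ⟨s, hs, hfs⟩ := intermediate_value_Icc hb0 hcont.continuousOn
    (show (1 : ℝ) ∈ Set.Icc (f 0) (f b) from ⟨by simp [hzero], hone⟩)
  refine ⟨s, hs.1.lt_of_ne ?_, hfs⟩
  rintro rfl
  exact zero_ne_one (hzero.symm.trans hfs)

/-- Acting by `t > 0` on `x` can be absorbed by dividing the scaling parameter by `t`. -/
theorem sum_div_rpow_mul_norm_sq_smul {ι : Type*} [Fintype ι] (w : ι → ℝ) (x : ι → ℂ)
    {s t : ℝ} (hs : 0 ≤ s) (ht : 0 < t) :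
    ∑ i, (s / t) ^ (2 * w i) * ‖((t ^ w i : ℝ) : ℂ) * x i‖ ^ 2 =
      ∑ i, s ^ (2 * w i) * ‖x i‖ ^ 2 := by
  refine Finset.sum_congr rfl fun i _ => ?_
  have htw : 0 < t ^ w i := Real.rpow_pos_of_pos ht _
  have hsq : t ^ (2 * w i) = (t ^ w i) ^ 2 := by
    rw [mul_comm, Real.rpow_mul ht.le, Real.rpow_two]
  rw [norm_mul, Complex.norm_of_nonneg htw.le, Real.div_rpow hs ht.le, hsq]
  field_simp

/-- For weights `w i ≥ 1` and `x ≠ 0` there is a unique `s > 0` with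
`∑ i, s^(2 w i) ‖x i‖² = 1`, and the resulting scaling parameter satisfies
`s(t · x) = s(x) / t` for the scaling action `(t · x) i = t^(w i) * x i`. -/
theorem stmt_3 (m : ℕ) (hm : 1 ≤ m) (w : Fin m → ℝ) (hw : ∀ i, 1 ≤ w i) :
    (∀ x : Fin m → ℂ, x ≠ 0 →
      ∃! s : ℝ, 0 < s ∧ ∑ i, s ^ (2 * w i) * ‖x i‖ ^ 2 = 1) ∧
    (∀ S : (Fin m → ℂ) → ℝ,
      (∀ x : Fin m → ℂ, x ≠ 0 →
        0 < S x ∧ ∑ i, (S x) ^ (2 * w i) * ‖x i‖ ^ 2 = 1) →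
      ∀ x : Fin m → ℂ, x ≠ 0 → ∀ t : ℝ, 0 < t →
        S (fun i => ((t ^ (w i) : ℝ) : ℂ) * x i) = S x / t) := by
  have hw0 (i : Fin m) : 0 < w i := one_pos.trans_le (hw i)
  refine ⟨fun x hx => ?_, fun S hS x hx t ht => ?_⟩
  · obtain ⟨s, hs, hs1⟩ := exists_pos_sum_rpow_mul_norm_sq_eq_one hw0 hx
    exact ⟨s, ⟨hs, hs1⟩, fun r hr => (strictMonoOn_sum_rpow_mul_norm_sq hw0 hx).injOn
      hr.1.le hs.le (hr.2.trans hs1.symm)⟩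
  · have htx : (fun i => ((t ^ (w i) : ℝ) : ℂ) * x i) ≠ 0 := by
      obtain ⟨j, hj⟩ := Function.ne_iff.mp hx
      exact Function.ne_iff.mpr ⟨j, mul_ne_zero
        (Complex.ofReal_ne_zero.mpr (Real.rpow_pos_of_pos ht _).ne') hj⟩
    obtain ⟨hpos, hsum⟩ := hS x hx
    obtain ⟨hpos', hsum'⟩ := hS _ htx
    exact (strictMonoOn_sum_rpow_mul_norm_sq hw0 htx).injOn hpos'.le (div_pos hpos ht).le
      (hsum'.trans ((sum_div_rpow_mul_norm_sq_smul w x hpos.le ht).trans hsum).symm)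
end

section
/- Let m ≥ 2 be a real number, μ ≥ 0, c > 0, and let χ : ℝ → ℝ be a continuous function whose support is a compact subset of (0, ∞). Then there exists a function f : ℝ → ℝ, twice continuously differentiable on (0, ∞), satisfying (deriv (deriv f)) r + ((m − 1) / r) * (deriv f) r − (μ / r²) * f r − c² * f r = χ r for all r > 0, and there exists a constant C such that |f r| ≤ C for all r ∈ (0, 1] and |f r| ≤ C * Real.exp (−c * r / 2) for all r ≥ 1. -/
open MeasureTheory Set Filter Topology

/-- Differentiation under the integral sign for `r ↦ ∫ A θ e^{c r cos θ} dθ`. -/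
theorem hasDerivAt_integral_mul_exp_cos {A : ℝ → ℝ} (hA : Continuous A) (c r : ℝ) :
    HasDerivAt (fun r => ∫ θ in (0 : ℝ)..Real.pi, A θ * Real.exp (c * r * Real.cos θ))
      (∫ θ in (0 : ℝ)..Real.pi, A θ * (c * Real.cos θ) * Real.exp (c * r * Real.cos θ)) r := by
  have hcont : ∀ x : ℝ, Continuous fun θ => A θ * Real.exp (c * x * Real.cos θ) := fun x => by
    fun_prop
  have hcont' : ∀ x : ℝ,
      Continuous fun θ => A θ * (c * Real.cos θ) * Real.exp (c * x * Real.cos θ) := fun x => by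
    fun_prop
  refine (intervalIntegral.hasDerivAt_integral_of_dominated_loc_of_deriv_le
    (F := fun x θ => A θ * Real.exp (c * x * Real.cos θ))
    (F' := fun x θ => A θ * (c * Real.cos θ) * Real.exp (c * x * Real.cos θ))
    (bound := fun θ => |A θ| * |c| * Real.exp (|c| * (|r| + 1)))
    (Metric.ball_mem_nhds r one_pos)
    (Eventually.of_forall fun x => (hcont x).aestronglyMeasurable)
    ((hcont r).intervalIntegrable _ _) (hcont' r).aestronglyMeasurable ?_ ?_ ?_).2
  · refine Eventually.of_forall fun θ _ x hx => ?_
    have hx' : |x| ≤ |r| + 1 := by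
      have h1 : |x - r| < 1 := by simpa [Real.dist_eq] using hx
      have h2 := abs_sub_abs_le_abs_sub x r
      linarith
    rw [Real.norm_eq_abs, abs_mul, abs_mul, abs_mul, Real.abs_exp]
    have hcos := Real.abs_cos_le_one θ
    have hexp : c * x * Real.cos θ ≤ |c| * (|r| + 1) := by
      refine (le_abs_self _).trans ?_
      rw [abs_mul, abs_mul]
      calc |c| * |x| * |Real.cos θ| ≤ |c| * |x| * 1 := by gcongr
        _ ≤ |c| * (|r| + 1) := by rw [mul_one]; gcongr
    calc |A θ| * (|c| * |Real.cos θ|) * Real.exp (c * x * Real.cos θ)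
        ≤ |A θ| * (|c| * 1) * Real.exp (|c| * (|r| + 1)) := by gcongr
      _ = _ := by rw [mul_one]
  · exact Continuous.intervalIntegrable (by fun_prop) _ _
  · refine Eventually.of_forall fun θ _ x _ => ?_
    have h : HasDerivAt (fun x : ℝ => c * x * Real.cos θ) (c * Real.cos θ) x := by
      simpa using ((hasDerivAt_id x).const_mul c).mul_const (Real.cos θ)
    refine (h.exp.const_mul (A θ)).congr_deriv ?_
    ring

/-- Integration by parts for the Poisson representation of the modified Bessel function. -/
theorem integral_sin_rpow_mul_cos_mul_exp {N : ℝ} (hN : 0 ≤ N) (a : ℝ) :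
    (N + 1) * ∫ θ in (0 : ℝ)..Real.pi,
        Real.sin θ ^ N * Real.cos θ * Real.exp (a * Real.cos θ) =
      a * ∫ θ in (0 : ℝ)..Real.pi,
        Real.sin θ ^ N * Real.sin θ ^ 2 * Real.exp (a * Real.cos θ) := by
  have hs : Continuous fun θ => Real.sin θ ^ N := Real.continuous_sin.rpow_const fun _ => Or.inr hN
  have hs1 : Continuous fun θ => Real.sin θ ^ (N + 1) :=
    Real.continuous_sin.rpow_const fun _ => Or.inr (by linarith)
  have key := intervalIntegral.integral_eq_sub_of_hasDerivAt_of_le Real.pi_pos.le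
    (f := fun θ => Real.sin θ ^ (N + 1) * Real.exp (a * Real.cos θ))
    (f' := fun θ => (N + 1) * (Real.sin θ ^ N * Real.cos θ * Real.exp (a * Real.cos θ)) -
      a * (Real.sin θ ^ N * Real.sin θ ^ 2 * Real.exp (a * Real.cos θ)))
    (Continuous.continuousOn (by fun_prop)) ?_
    (Continuous.intervalIntegrable (by fun_prop) _ _)
  · rw [intervalIntegral.integral_sub (Continuous.intervalIntegrable (by fun_prop) _ _)
      (Continuous.intervalIntegrable (by fun_prop) _ _),
      intervalIntegral.integral_const_mul, intervalIntegral.integral_const_mul] at key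
    have h0 : (0 : ℝ) ^ (N + 1) = 0 := Real.zero_rpow (by linarith)
    simp only [Real.sin_pi, Real.sin_zero, h0] at key
    linarith
  · intro θ hθ
    have hpos := Real.sin_pos_of_pos_of_lt_pi hθ.1 hθ.2
    have h1 := (Real.hasDerivAt_sin θ).rpow_const (p := N + 1) (Or.inl hpos.ne')
    have h2 := ((Real.hasDerivAt_cos θ).const_mul a).exp
    refine (h1.mul h2).congr_deriv ?_
    rw [add_sub_cancel_right, Real.rpow_add hpos, Real.rpow_one]
    ring

/-- The Poisson integral solves `w'' + ((N+1)/r) w' = c² w`, is positive, monotone, and grows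
at least like `e^{cr/2}`. -/
theorem exists_poisson_solution {N c : ℝ} (hN : 0 ≤ N) (hc : 0 < c) :
    ∃ w w₁ w₂ : ℝ → ℝ, (∀ r, HasDerivAt w (w₁ r) r) ∧ (∀ r, HasDerivAt w₁ (w₂ r) r) ∧
      (∀ r, r * w₂ r + (N + 1) * w₁ r = c ^ 2 * r * w r) ∧
      (∀ r, 0 ≤ r → 0 ≤ w₁ r) ∧
      ∃ k > 0, ∀ r, 0 ≤ r → k * Real.exp (c * r / 2) ≤ w r := by
  have hs : Continuous fun θ => Real.sin θ ^ N := Real.continuous_sin.rpow_const fun _ => Or.inr hN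
  have hw₁ : ∀ r : ℝ, (∫ θ in (0 : ℝ)..Real.pi,
      Real.sin θ ^ N * (c * Real.cos θ) * Real.exp (c * r * Real.cos θ)) =
      c * ∫ θ in (0 : ℝ)..Real.pi,
        Real.sin θ ^ N * Real.cos θ * Real.exp (c * r * Real.cos θ) := fun r => by
    rw [← intervalIntegral.integral_const_mul]
    congr 1 with θ
    ring
  refine ⟨fun r => ∫ θ in (0 : ℝ)..Real.pi, Real.sin θ ^ N * Real.exp (c * r * Real.cos θ),
    fun r => ∫ θ in (0 : ℝ)..Real.pi,
      Real.sin θ ^ N * (c * Real.cos θ) * Real.exp (c * r * Real.cos θ),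
    fun r => ∫ θ in (0 : ℝ)..Real.pi,
      Real.sin θ ^ N * (c * Real.cos θ) * (c * Real.cos θ) * Real.exp (c * r * Real.cos θ),
    hasDerivAt_integral_mul_exp_cos hs c,
    hasDerivAt_integral_mul_exp_cos (by fun_prop) c, fun r => ?_, fun r hr => ?_,
    ∫ θ in (0 : ℝ)..(Real.pi / 3), Real.sin θ ^ N, ?_, fun r hr => ?_⟩
  · have hparts := integral_sin_rpow_mul_cos_mul_exp hN (c * r)
    have hpyth : (∫ θ in (0 : ℝ)..Real.pi, Real.sin θ ^ N * (c * Real.cos θ) *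
        (c * Real.cos θ) * Real.exp (c * r * Real.cos θ)) =
        c ^ 2 * (∫ θ in (0 : ℝ)..Real.pi, Real.sin θ ^ N * Real.exp (c * r * Real.cos θ)) -
        c ^ 2 * ∫ θ in (0 : ℝ)..Real.pi,
          Real.sin θ ^ N * Real.sin θ ^ 2 * Real.exp (c * r * Real.cos θ) := by
      rw [← intervalIntegral.integral_const_mul, ← intervalIntegral.integral_const_mul,
        ← intervalIntegral.integral_sub (Continuous.intervalIntegrable (by fun_prop) _ _)
          (Continuous.intervalIntegrable (by fun_prop) _ _)]
      congr 1 with θ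
      rw [Real.sin_sq]
      ring
    simp only [hw₁, hpyth]
    linear_combination c * hparts
  · have hparts := integral_sin_rpow_mul_cos_mul_exp hN (c * r)
    have hnn : 0 ≤ ∫ θ in (0 : ℝ)..Real.pi,
        Real.sin θ ^ N * Real.sin θ ^ 2 * Real.exp (c * r * Real.cos θ) :=
      intervalIntegral.integral_nonneg Real.pi_pos.le fun θ hθ => by
        have := Real.sin_nonneg_of_nonneg_of_le_pi hθ.1 hθ.2
        positivity
    simp only [hw₁]
    refine mul_nonneg hc.le (nonneg_of_mul_nonneg_right (a := N + 1) ?_ (by linarith))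
    rw [hparts]
    positivity
  · refine intervalIntegral.intervalIntegral_pos_of_pos_on (hs.intervalIntegrable _ _)
      (fun θ hθ => ?_) (by positivity)
    exact Real.rpow_pos_of_pos
      (Real.sin_pos_of_pos_of_lt_pi hθ.1 (by linarith [hθ.2, Real.pi_pos])) _
  · have hcont : Continuous fun θ => Real.sin θ ^ N * Real.exp (c * r * Real.cos θ) := by fun_prop
    have hpi := Real.pi_pos
    beta_reduce
    rw [← intervalIntegral.integral_add_adjacent_intervals
      (hcont.intervalIntegrable 0 (Real.pi / 3)) (hcont.intervalIntegrable _ Real.pi),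
      ← intervalIntegral.integral_mul_const]
    have h1 : (∫ θ in (0 : ℝ)..(Real.pi / 3), Real.sin θ ^ N * Real.exp (c * r / 2)) ≤
        ∫ θ in (0 : ℝ)..(Real.pi / 3), Real.sin θ ^ N * Real.exp (c * r * Real.cos θ) := by
      refine intervalIntegral.integral_mono_on (by positivity)
        (Continuous.intervalIntegrable (by fun_prop) _ _) (hcont.intervalIntegrable _ _)
        fun θ hθ => ?_
      have hsin := Real.sin_nonneg_of_nonneg_of_le_pi hθ.1 (by linarith [hθ.2])
      have hcos : 1 / 2 ≤ Real.cos θ := by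
        rw [← Real.cos_pi_div_three]
        exact Real.cos_le_cos_of_nonneg_of_le_pi hθ.1 (by linarith) hθ.2
      have : c * r / 2 ≤ c * r * Real.cos θ := by
        have : 0 ≤ c * r := by positivity
        nlinarith
      gcongr
    have h2 : 0 ≤ ∫ θ in (Real.pi / 3)..Real.pi,
        Real.sin θ ^ N * Real.exp (c * r * Real.cos θ) :=
      intervalIntegral.integral_nonneg (by linarith) fun θ hθ => by
        have := Real.sin_nonneg_of_nonneg_of_le_pi (by linarith [hθ.1]) hθ.2
        positivity
    linarith

/-- A positive monotone solution of the homogeneous radial equation which is continuous at `0`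
and grows at least like `e^{cr/2}`. -/
theorem exists_growing_radial_solution {m μ c : ℝ} (hm : 2 ≤ m) (hμ : 0 ≤ μ) (hc : 0 < c) :
    ∃ u u₁ : ℝ → ℝ, Continuous u ∧ (∀ r, 0 < r → 0 < u r) ∧ MonotoneOn u (Ioi 0) ∧
      (∀ r, 0 < r → HasDerivAt u (u₁ r) r) ∧
      (∀ r, 0 < r → HasDerivAt u₁ ((μ / r ^ 2 + c ^ 2) * u r - (m - 1) / r * u₁ r) r) ∧
      ∃ k > 0, ∀ r, 1 ≤ r → k * Real.exp (c * r / 2) ≤ u r := by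
  obtain ⟨α, hα, hαμ⟩ : ∃ α : ℝ, 0 ≤ α ∧ α * (α - 1) + (m - 1) * α = μ := by
    have hsq := Real.sq_sqrt (show 0 ≤ (m - 2) ^ 2 + 4 * μ by positivity)
    refine ⟨(√((m - 2) ^ 2 + 4 * μ) - (m - 2)) / 2, ?_, by linear_combination hsq / 4⟩
    have := Real.le_sqrt_of_sq_le (show (m - 2) ^ 2 ≤ (m - 2) ^ 2 + 4 * μ by linarith)
    linarith
  obtain ⟨w, w₁, w₂, hw, hw₁, hode, hw₁nn, k, hk, hgrow⟩ :=
    exists_poisson_solution (N := 2 * α + m - 2) (by linarith) hc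
  have hwpos : ∀ r, 0 ≤ r → 0 < w r := fun r hr => lt_of_lt_of_le (by positivity) (hgrow r hr)
  have hu : ∀ r, 0 < r → HasDerivAt (fun r => r ^ α * w r)
      (α * r ^ (α - 1) * w r + r ^ α * w₁ r) r := fun r hr =>
    (Real.hasDerivAt_rpow_const (Or.inl hr.ne')).mul (hw r)
  have hcont : Continuous fun r => r ^ α * w r :=
    (Real.continuous_rpow_const hα).mul
      (continuous_iff_continuousAt.2 fun r => (hw r).continuousAt)
  refine ⟨fun r => r ^ α * w r, fun r => α * r ^ (α - 1) * w r + r ^ α * w₁ r, hcont,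
    fun r hr => mul_pos (Real.rpow_pos_of_pos hr _) (hwpos r hr.le), ?_, hu, fun r hr => ?_,
    k, hk, fun r hr => ?_⟩
  · refine monotoneOn_of_deriv_nonneg (convex_Ioi 0) hcont.continuousOn ?_ ?_
    · rw [interior_Ioi]
      exact fun r hr => (hu r hr).differentiableAt.differentiableWithinAt
    · rw [interior_Ioi]
      intro r hr
      rw [(hu r hr).deriv]
      have hr' : (0 : ℝ) < r := hr
      have := hwpos r hr'.le
      have := hw₁nn r hr'.le
      positivity
  · have h1 := ((Real.hasDerivAt_rpow_const (p := α - 1) (Or.inl hr.ne')).const_mul α).mul (hw r)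
    have h2 := (Real.hasDerivAt_rpow_const (p := α) (Or.inl hr.ne')).mul (hw₁ r)
    have hw₂ : w₂ r = c ^ 2 * w r - (2 * α + m - 1) / r * w₁ r := by
      have := hode r
      field_simp
      linear_combination this
    refine (h1.add h2).congr_deriv ?_
    beta_reduce
    rw [hw₂, Real.rpow_sub_one hr.ne' (α - 1), Real.rpow_sub_one hr.ne' α, ← hαμ]
    field_simp
    ring
  · calc k * Real.exp (c * r / 2) ≤ w r := hgrow r (by linarith)
      _ = 1 * w r := (one_mul _).symm
      _ ≤ r ^ α * w r := by
        have := (hwpos r (by linarith)).le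
        gcongr
        exact Real.one_le_rpow hr hα

/-- A function on `(0, ∞)` given with two derivatives is `C²` if the second one is continuous. -/
theorem contDiffOn_two_of_hasDerivAt {f f₁ f₂ : ℝ → ℝ} {s : Set ℝ} (hs : IsOpen s)
    (hf : ∀ r ∈ s, HasDerivAt f (f₁ r) r) (hf₁ : ∀ r ∈ s, HasDerivAt f₁ (f₂ r) r)
    (hf₂ : ContinuousOn f₂ s) : ContDiffOn ℝ 2 f s := by
  have h1 : ContDiffOn ℝ 1 f₁ s := by
    rw [show (1 : WithTop ℕ∞) = 0 + 1 from rfl, contDiffOn_succ_iff_deriv_of_isOpen hs]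
    refine ⟨fun r hr => (hf₁ r hr).differentiableAt.differentiableWithinAt, by simp, ?_⟩
    rw [contDiffOn_zero]
    exact hf₂.congr fun r hr => (hf₁ r hr).deriv
  rw [show (2 : WithTop ℕ∞) = 1 + 1 from rfl, contDiffOn_succ_iff_deriv_of_isOpen hs]
  exact ⟨fun r hr => (hf r hr).differentiableAt.differentiableWithinAt, by simp,
    h1.congr fun r hr => (hf r hr).deriv⟩

/-- Solvability of the radial equation (5.2): for `m ≥ 2`, `μ ≥ 0`, `c > 0` and a
continuous `χ` with compact support in `(0,∞)`, there is a solution `f` of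
`f'' + ((m-1)/r) f' - (μ/r²) f - c² f = χ` on `(0,∞)` that is bounded near `0`
and decays exponentially at infinity. -/
theorem stmt_10 (m μ c : ℝ) (hm : 2 ≤ m) (hμ : 0 ≤ μ) (hc : 0 < c)
    (χ : ℝ → ℝ) (hχ : Continuous χ)
    (hsupp : IsCompact (tsupport χ)) (hsupp' : tsupport χ ⊆ Set.Ioi (0 : ℝ)) :
    ∃ f : ℝ → ℝ, ContDiffOn ℝ 2 f (Set.Ioi (0 : ℝ)) ∧
      (∀ r : ℝ, 0 < r →
        deriv (deriv f) r + ((m - 1) / r) * deriv f r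
          - (μ / r ^ 2) * f r - c ^ 2 * f r = χ r) ∧
      ∃ C : ℝ, (∀ r ∈ Set.Ioc (0 : ℝ) 1, |f r| ≤ C) ∧
        (∀ r : ℝ, 1 ≤ r → |f r| ≤ C * Real.exp (-c * r / 2)) := by
  obtain ⟨u, u₁, hu, hupos, humono, hu₁, hu₂, k, hk, hgrow⟩ :=
    exists_growing_radial_solution hm hμ hc
  obtain ⟨a, ha, ha'⟩ : ∃ a > 0, ∀ r < a, χ r = 0 := by
    have hmem : (tsupport χ)ᶜ ∈ 𝓝 (0 : ℝ) :=
      (isClosed_tsupport χ).isOpen_compl.mem_nhds fun h => lt_irrefl (0 : ℝ) (hsupp' h)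
    obtain ⟨a, ha, hball⟩ := Metric.mem_nhds_iff.1 hmem
    refine ⟨a, ha, fun r hr => image_eq_zero_of_notMem_tsupport fun h => ?_⟩
    have hr0 : 0 < r := hsupp' h
    exact hball (show r ∈ Metric.ball 0 a by simpa [abs_of_pos hr0] using hr) h
  have hp : Continuous fun r : ℝ => r ^ (m - 1) := Real.continuous_rpow_const (by linarith)
  set q : ℝ → ℝ := fun r => r ^ (m - 1) * u r * χ r with hq_def
  have hq : Continuous q := (hp.mul hu).mul hχ
  have hqi : Integrable q := hq.integrable_of_hasCompactSupport (HasCompactSupport.mul_left hsupp)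
  set F : ℝ → ℝ := fun r => ∫ s in (0 : ℝ)..r, q s with hF_def
  have hF : ∀ r, HasDerivAt F (q r) r := fun r =>
    intervalIntegral.integral_hasDerivAt_right (hq.intervalIntegrable _ _)
      (hq.stronglyMeasurableAtFilter _ _) hq.continuousAt
  have hFcont : Continuous F := continuous_iff_continuousAt.2 fun r => (hF r).continuousAt
  obtain ⟨M, hM, hFM⟩ : ∃ M, 0 ≤ M ∧ ∀ r, 0 ≤ r → |F r| ≤ M := by
    refine ⟨∫ s, ‖q s‖, by positivity, fun r hr => ?_⟩
    rw [← Real.norm_eq_abs, hF_def]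
    simp only [intervalIntegral.integral_of_le hr]
    exact (norm_integral_le_integral_norm _).trans
      (setIntegral_le_integral hqi.norm (Eventually.of_forall fun _ => norm_nonneg _))
  have hF0 : ∀ r, 0 < r → r < a → F r = 0 := fun r hr hra => by
    refine (intervalIntegral.integral_congr (g := fun _ => 0) fun s hs => ?_).trans (by simp)
    rw [uIcc_of_le hr.le] at hs
    simp [hq_def, ha' s (hs.2.trans_lt hra)]
  set h : ℝ → ℝ := fun r => F r / (r ^ (m - 1) * u r ^ 2) with hh_def
  have hhc : ContinuousOn h (Ioi 0) :=
    hFcont.continuousOn.div (hp.mul (hu.pow 2)).continuousOn fun r hr =>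
      (mul_pos (Real.rpow_pos_of_pos hr _) (pow_pos (hupos r hr) 2)).ne'
  have hbound : ∀ r s, 1 ≤ r → r ≤ s → u r * |h s| ≤ M / k * Real.exp (-(c / 2) * s) := by
    intro r s hr hs
    have hs0 : 0 < s := by linarith
    have hus := hupos s hs0
    have hp1 : 1 ≤ s ^ (m - 1) := Real.one_le_rpow (hr.trans hs) (by linarith)
    have hur : u r ≤ u s := humono (show (0 : ℝ) < r by linarith) hs0 hs
    have hg := hgrow s (hr.trans hs)
    calc u r * |h s| ≤ u s * |h s| := by gcongr
      _ = |F s| / (s ^ (m - 1) * u s) := by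
        rw [hh_def]
        simp only [abs_div, abs_of_pos (show 0 < s ^ (m - 1) * u s ^ 2 by positivity)]
        field_simp
      _ ≤ M / (1 * (k * Real.exp (c * s / 2))) := by
        gcongr
        exact hFM s hs0.le
      _ = M / k * Real.exp (-(c / 2) * s) := by
        rw [show -(c / 2) * s = -(c * s / 2) by ring, Real.exp_neg]
        field_simp
  have hexp := integrableOn_exp_mul_Ioi (a := -(c / 2)) (by linarith)
  have hhi : IntegrableOn h (Ioi 0) := by
    have h1 : IntegrableOn h (Ioo 0 a) :=
      integrableOn_zero.congr_fun (fun r hr => by simp [hh_def, hF0 r hr.1 hr.2]) measurableSet_Ioo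
    have h2 : IntegrableOn h (Icc a (max a 1)) :=
      (hhc.mono fun r hr => ha.trans_le hr.1).integrableOn_Icc
    have h3 : IntegrableOn h (Ioi 1) := by
      refine Integrable.mono' (((hexp 1).const_mul (M / k)).div_const (u 1))
        ((hhc.mono (Ioi_subset_Ioi zero_le_one)).aestronglyMeasurable measurableSet_Ioi) ?_
      refine (ae_restrict_iff' measurableSet_Ioi).2 (Eventually.of_forall fun s hs => ?_)
      rw [le_div_iff₀ (hupos 1 one_pos), mul_comm]
      exact hbound 1 s le_rfl (le_of_lt hs)
    refine ((h1.union h2).union h3).mono_set fun r hr => ?_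
    rcases lt_or_ge r a with h | h
    · exact Or.inl (Or.inl ⟨hr, h⟩)
    rcases le_or_gt r (max a 1) with h' | h'
    · exact Or.inl (Or.inr ⟨h, h'⟩)
    · exact Or.inr (lt_of_le_of_lt (le_max_right a 1) h')
  set g : ℝ → ℝ := fun r => -∫ s in Ioi r, h s with hg_def
  have hg : ∀ r, 0 < r → HasDerivAt g (h r) r := by
    intro r hr
    have heq : g =ᶠ[𝓝 r] fun x => (∫ s in (0 : ℝ)..x, h s) - ∫ s in Ioi 0, h s := by
      filter_upwards [Ioi_mem_nhds hr] with x hx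
      have := intervalIntegral.integral_interval_add_Ioi'
        ((intervalIntegrable_iff_integrableOn_Ioc_of_le (le_of_lt hx)).2
          (hhi.mono_set Ioc_subset_Ioi_self)) (hhi.mono_set (Ioi_subset_Ioi (le_of_lt hx)))
      simp only [hg_def]
      linarith
    refine HasDerivAt.congr_of_eventuallyEq (HasDerivAt.sub_const _ ?_) heq
    exact intervalIntegral.integral_hasDerivAt_right
      ((intervalIntegrable_iff_integrableOn_Ioc_of_le hr.le).2 (hhi.mono_set Ioc_subset_Ioi_self))
      (hhc.stronglyMeasurableAtFilter isOpen_Ioi r hr) (hhc.continuousAt (Ioi_mem_nhds hr))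
  have hf : ∀ r, 0 < r → HasDerivAt (fun r => u r * g r) (u₁ r * g r + u r * h r) r :=
    fun r hr => (hu₁ r hr).mul (hg r hr)
  have hf₁ : ∀ r, 0 < r → HasDerivAt (fun r => u₁ r * g r + u r * h r)
      (χ r + (μ / r ^ 2 + c ^ 2) * (u r * g r)
        - (m - 1) / r * (u₁ r * g r + u r * h r)) r := by
    intro r hr
    have hur := hupos r hr
    have hpr := Real.rpow_pos_of_pos hr (m - 1)
    have hpd : HasDerivAt (fun r : ℝ => r ^ (m - 1)) ((m - 1) * (r ^ (m - 1) / r)) r := by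
      rw [← Real.rpow_sub_one hr.ne']
      exact Real.hasDerivAt_rpow_const (Or.inl hr.ne')
    have hd := (hF r).div (hpd.mul ((hu₁ r hr).pow 2))
      (mul_pos hpr (pow_pos hur 2)).ne'
    refine (((hu₂ r hr).mul (hg r hr)).add ((hu₁ r hr).mul hd)).congr_deriv ?_
    simp only [hh_def, hq_def, Pi.mul_apply, Pi.pow_apply, Pi.div_apply]
    field_simp
    ring
  refine ⟨fun r => u r * g r, contDiffOn_two_of_hasDerivAt isOpen_Ioi hf hf₁ ?_, fun r hr => ?_,
    max (u 1 * ∫ s in Ioi 0, |h s|) (M / k * (2 / c)), fun r hr => ?_, fun r hr => ?_⟩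
  · have hid : ContinuousOn (fun r : ℝ => r) (Ioi 0) := continuousOn_id
    have hne : ∀ r ∈ Ioi (0 : ℝ), r ≠ 0 := fun r hr => ne_of_gt hr
    have c0 : ContinuousOn (fun r => u r * g r) (Ioi 0) :=
      fun r hr => (hf r hr).continuousAt.continuousWithinAt
    have c1 : ContinuousOn (fun r => u₁ r * g r + u r * h r) (Ioi 0) :=
      fun r hr => (hf₁ r hr).continuousAt.continuousWithinAt
    exact (hχ.continuousOn.add (((continuousOn_const.div (hid.pow 2)
      fun r hr => pow_ne_zero 2 (hne r hr)).add continuousOn_const).mul c0)).sub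
      ((continuousOn_const.div hid hne).mul c1)
  · have hd : deriv (fun r => u r * g r) =ᶠ[𝓝 r] fun r => u₁ r * g r + u r * h r := by
      filter_upwards [Ioi_mem_nhds hr] with x hx using (hf x hx).deriv
    rw [hd.deriv_eq, (hf₁ r hr).deriv, (hf r hr).deriv]
    ring
  · refine le_trans ?_ (le_max_left _ _)
    rw [abs_mul, abs_of_pos (hupos r hr.1)]
    have h1 : u r ≤ u 1 := humono hr.1 (mem_Ioi.2 one_pos) hr.2
    have h2 : |g r| ≤ ∫ s in Ioi 0, |h s| := by
      simp only [hg_def, abs_neg]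
      exact (norm_integral_le_integral_norm _).trans
        (setIntegral_mono_set hhi.norm (Eventually.of_forall fun _ => norm_nonneg _)
          (Ioi_subset_Ioi hr.1.le).eventuallyLE)
    have := hupos 1 one_pos
    gcongr
  · have hr0 : 0 < r := by linarith
    refine le_trans ?_ (mul_le_mul_of_nonneg_right (le_max_right _ _) (Real.exp_pos _).le)
    rw [abs_mul, abs_of_pos (hupos r hr0)]
    have h2 : |g r| ≤ ∫ s in Ioi r, |h s| := by
      simp only [hg_def, abs_neg]
      exact norm_integral_le_integral_norm h
    calc u r * |g r| ≤ u r * ∫ s in Ioi r, |h s| := by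
          have := hupos r hr0
          gcongr
      _ = ∫ s in Ioi r, u r * |h s| := (integral_const_mul _ _).symm
      _ ≤ ∫ s in Ioi r, M / k * Real.exp (-(c / 2) * s) :=
        setIntegral_mono_on ((hhi.mono_set (Ioi_subset_Ioi hr0.le)).abs.const_mul _)
          ((hexp r).const_mul _) measurableSet_Ioi fun s hs => hbound r s hr (le_of_lt hs)
      _ = M / k * (2 / c) * Real.exp (-c * r / 2) := by
        rw [integral_const_mul, integral_exp_mul_Ioi (by linarith),
          show -(c / 2) * r = -c * r / 2 by ring]
        field_simp
end

section
/- Let E be a normed complex vector space, N : ℕ, and c : Fin (N+1) → Fin (N+1) → E. Define f : ℂ → E by f(z) = ∑ i, ∑ j, (z^(i : ℕ) * (starRingEnd ℂ z)^(j : ℕ)) • c i j. If f is bounded, i.e. there exists M with ‖f z‖ ≤ M for all z ∈ ℂ, then c i j = 0 whenever (i, j) ≠ (0, 0); in particular f is the constant function c 0 0. -/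
open Polynomial Filter in
theorem Polynomial.coeff_eq_zero_of_norm_eval_ofReal_le {p : ℂ[X]} {M : ℝ}
    (hM : ∀ r : ℝ, ‖p.eval (r : ℂ)‖ ≤ M) {k : ℕ} (hk : k ≠ 0) : p.coeff k = 0 := by
  have hdeg : ¬ 0 < p.degree := fun h => by
    have hz : Tendsto (fun r : ℝ => ‖(r : ℂ)‖) atTop atTop := by
      simpa using tendsto_abs_atTop_atTop (G := ℝ)
    obtain ⟨r, hr⟩ := ((p.tendsto_norm_atTop h hz).eventually_gt_atTop M).exists
    exact absurd (hM r) (not_le.mpr hr)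
  apply coeff_eq_zero_of_degree_lt
  exact (not_lt.mp hdeg).trans_lt (by exact_mod_cast Nat.pos_of_ne_zero hk)

theorem Complex.infinite_unit_sphere : (Metric.sphere (0 : ℂ) 1).Infinite := by
  apply IsPreconnected.infinite_of_nontrivial
  · exact isPreconnected_sphere (by rw [Complex.rank_real_complex]; norm_num) 0 1
  · exact ⟨1, by simp, -1, by simp, by norm_num⟩

open Polynomial in
/-- The coefficients of a bounded complex-valued polynomial in `z` and `z̄` vanish, except possibly
the constant one. -/
theorem coeff_eq_zero_of_norm_sum_pow_mul_conj_pow_le {N : ℕ}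
    (a : Fin (N + 1) → Fin (N + 1) → ℂ) {M : ℝ}
    (hM : ∀ z : ℂ, ‖∑ i : Fin (N + 1), ∑ j : Fin (N + 1),
      z ^ (i : ℕ) * (starRingEnd ℂ z) ^ (j : ℕ) * a i j‖ ≤ M)
    {m n : Fin (N + 1)} (hmn : (m : ℕ) + n ≠ 0) : a m n = 0 := by
  -- Boundedness along the ray through `w` kills every homogeneous part of positive degree.
  have hray (w : ℂ) : ∑ i : Fin (N + 1), ∑ j : Fin (N + 1),
      (if (m : ℕ) + n = i + j then w ^ (i : ℕ) * (starRingEnd ℂ w) ^ (j : ℕ) * a i j else 0)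
        = 0 := by
    have h := Polynomial.coeff_eq_zero_of_norm_eval_ofReal_le (M := M)
      (p := ∑ i : Fin (N + 1), ∑ j : Fin (N + 1),
        C (w ^ (i : ℕ) * (starRingEnd ℂ w) ^ (j : ℕ) * a i j) * X ^ ((i : ℕ) + j))
      (fun r => by
        convert hM (r * w) using 2
        simp only [eval_finsetSum, eval_mul, eval_C, eval_pow, eval_X, map_mul, Complex.conj_ofReal]
        refine Finset.sum_congr rfl fun i _ => Finset.sum_congr rfl fun j _ => ?_
        ring) hmn
    simpa only [finsetSum_coeff, coeff_C_mul_X_pow] using h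
  -- On the unit circle `z̄ = z⁻¹`, so the homogeneous part is a Laurent polynomial in `z`.
  have hQ : (∑ i : Fin (N + 1), ∑ j : Fin (N + 1),
      C (if (m : ℕ) + n = i + j then a i j else 0) * X ^ ((i : ℕ) + (N - j)) : ℂ[X]) = 0 := by
    refine eq_zero_of_infinite_isRoot _ (Complex.infinite_unit_sphere.mono fun w hw => ?_)
    have hw' : w * starRingEnd ℂ w = 1 := by
      rw [Complex.mul_conj, Complex.normSq_eq_norm_sq, mem_sphere_zero_iff_norm.mp hw]; simp
    refine Eq.trans ?_ ((congrArg (w ^ N * ·) (hray w)).trans (mul_zero _))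
    simp only [eval_finsetSum, eval_mul, eval_C, eval_pow, eval_X, Finset.mul_sum]
    refine Finset.sum_congr rfl fun i _ => Finset.sum_congr rfl fun j _ => ?_
    split_ifs
    · have hN : w ^ N = w ^ (N - (j : ℕ)) * w ^ (j : ℕ) := by
        rw [← pow_add, Nat.sub_add_cancel j.is_le]
      have hj : w ^ (j : ℕ) * (starRingEnd ℂ w) ^ (j : ℕ) = 1 := by rw [← mul_pow, hw', one_pow]
      rw [hN, pow_add]
      linear_combination (-(a i j) * w ^ (i : ℕ) * w ^ (N - (j : ℕ))) * hj
    · simp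
  have h := congrArg (fun p : ℂ[X] => p.coeff ((m : ℕ) + (N - n))) hQ
  simp only [finsetSum_coeff, coeff_C_mul_X_pow, coeff_zero] at h
  rw [Finset.sum_eq_single m, Finset.sum_eq_single n] at h
  · simpa using h
  · intro j _ hj
    have : (j : ℕ) ≠ n := fun h => hj (Fin.ext h)
    rw [if_neg (by omega)]
  · simp
  · intro i _ hi
    have : (i : ℕ) ≠ m := fun h => hi (Fin.ext h)
    refine Finset.sum_eq_zero fun j _ => ?_
    split_ifs <;> first | rfl | omega
  · simp


/-- A bounded polynomial in `z` and `z̄` with coefficients in a normed complex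
vector space is constant: all coefficients except the constant term vanish. -/
theorem stmt_11 (E : Type*) [NormedAddCommGroup E] [NormedSpace ℂ E] (N : ℕ)
    (c : Fin (N + 1) → Fin (N + 1) → E)
    (f : ℂ → E)
    (hf : ∀ z : ℂ, f z = ∑ i : Fin (N + 1), ∑ j : Fin (N + 1),
      (z ^ (i : ℕ) * (starRingEnd ℂ z) ^ (j : ℕ)) • c i j)
    (M : ℝ) (hM : ∀ z : ℂ, ‖f z‖ ≤ M) :
    (∀ i j : Fin (N + 1), (i, j) ≠ ((0 : Fin (N + 1)), (0 : Fin (N + 1))) → c i j = 0) ∧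
      ∀ z : ℂ, f z = c 0 0 := by
  have hc : ∀ i j : Fin (N + 1), (i, j) ≠ ((0 : Fin (N + 1)), (0 : Fin (N + 1))) → c i j = 0 := by
    intro i j hij
    have hsum : (i : ℕ) + j ≠ 0 := fun h =>
      hij (Prod.ext (Fin.ext (Nat.eq_zero_of_add_eq_zero_right h))
        (Fin.ext (Nat.eq_zero_of_add_eq_zero_left h)))
    refine SeparatingDual.eq_zero_of_forall_dual_eq_zero (R := ℂ) fun g => ?_
    refine coeff_eq_zero_of_norm_sum_pow_mul_conj_pow_le (fun i j => g (c i j))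
      (M := ‖g‖ * M) (fun z => ?_) hsum
    have hg : g (f z) = ∑ i : Fin (N + 1), ∑ j : Fin (N + 1),
        z ^ (i : ℕ) * (starRingEnd ℂ z) ^ (j : ℕ) * g (c i j) := by
      simp [hf]
    rw [← hg]
    exact g.le_opNorm_of_le (hM z)
  refine ⟨hc, fun z => ?_⟩
  rw [hf, Finset.sum_eq_single 0, Finset.sum_eq_single 0]
  · simp
  · intro j _ hj
    rw [hc 0 j (by simpa using hj), smul_zero]
  · simp
  · intro i _ hi
    exact Finset.sum_eq_zero fun j _ => by rw [hc i j (by simp [hi]), smul_zero]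
  · simp
end

section
/- For every n : ℕ there exists a constant C ≥ 0 with the following property. For all matrices A B : Matrix (Fin n) (Fin n) ℂ such that ‖A i j‖ ≤ 1 and ‖B i j‖ ≤ 1 for all indices i j, one has ‖(1 + A).det − (1 + B).det − ((A − B).trace)‖ ≤ C * (a + b) * e, where a = sup over (i,j) of ‖A i j‖, b = sup over (i,j) of ‖B i j‖, and e = sup over (i,j) of ‖(A − B) i j‖. -/
/-- On the closed unit ball, a `C²` map minus its linearization at `0` is Lipschitz with constant
proportional to the size of the arguments. -/
theorem ContDiff.exists_norm_sub_sub_fderiv_zero_le {E F : Type*}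
    [NormedAddCommGroup E] [NormedSpace ℂ E] [ProperSpace E]
    [NormedAddCommGroup F] [NormedSpace ℂ F] {f : E → F} (hf : ContDiff ℂ 2 f) :
    ∃ C : ℝ, 0 ≤ C ∧ ∀ x y : E, ‖x‖ ≤ 1 → ‖y‖ ≤ 1 →
      ‖f x - f y - fderiv ℂ f 0 (x - y)‖ ≤ C * (‖x‖ + ‖y‖) * ‖x - y‖ := by
  have hf' : ContDiff ℂ 1 (fderiv ℂ f) := hf.fderiv_right (by norm_num)
  obtain ⟨K, hK⟩ := (hf'.restrict_scalars ℝ).contDiffOn.exists_lipschitzOnWith one_ne_zero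
    (convex_closedBall (0 : E) 1) (isCompact_closedBall 0 1)
  refine ⟨K, K.2, fun x y hx hy => ?_⟩
  refine (convex_closedBall (0 : E) (max ‖x‖ ‖y‖)).norm_image_sub_le_of_norm_fderiv_le' (𝕜 := ℂ)
    (fun z _ => hf.differentiable two_ne_zero z) (fun z hz => ?_)
    (by simp) (by simp)
  rw [mem_closedBall_zero_iff] at hz
  calc ‖fderiv ℂ f z - fderiv ℂ f 0‖ ≤ K * ‖z - 0‖ :=
        hK.norm_sub_le (by simpa using hz.trans (max_le hx hy)) (by simp)
    _ ≤ K * (‖x‖ + ‖y‖) := by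
        rw [sub_zero]
        gcongr
        exact hz.trans (max_le_add_of_nonneg (norm_nonneg x) (norm_nonneg y))

theorem Matrix.contDiff_det_one_add {n : Type*} [Fintype n] [DecidableEq n] {k : WithTop ℕ∞} :
    ContDiff ℂ k (fun M : n → n → ℂ => (1 + Matrix.of M).det) := by
  simp only [Matrix.det_apply', Matrix.add_apply, Matrix.of_apply]
  fun_prop

theorem Matrix.fderiv_det_one_add_zero {n : Type*} [Fintype n] [DecidableEq n]
    (M : n → n → ℂ) :
    fderiv ℂ (fun M : n → n → ℂ => (1 + Matrix.of M).det) 0 M = (Matrix.of M).trace := by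
  have hline : HasDerivAt (fun t : ℂ => (1 + t • Matrix.of M).det)
      (fderiv ℂ (fun M : n → n → ℂ => (1 + Matrix.of M).det) 0 M) 0 := by
    have h := ((Matrix.contDiff_det_one_add (k := 1)).differentiable one_ne_zero
      (0 : n → n → ℂ)).hasFDerivAt.hasLineDerivAt M
    simpa only [HasLineDerivAt, zero_add, ← Matrix.smul_of] using h
  refine hline.unique ?_
  rw [funext fun t => Matrix.det_one_add_smul t (Matrix.of M)]
  generalize Polynomial.divX (R := ℂ) (Polynomial.divX _) = p
  have h := (((hasDerivAt_id (0 : ℂ)).const_mul (Matrix.of M).trace).const_add 1).add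
    ((p.hasDerivAt 0).mul ((hasDerivAt_id (0 : ℂ)).pow 2))
  convert h using 1
  · rfl
  · simp

theorem Matrix.norm_le_iSup_norm_entry {m n : Type*} [Fintype m] [Fintype n]
    (M : m → n → ℂ) : ‖M‖ ≤ ⨆ p : m × n, ‖M p.1 p.2‖ := by
  have h0 : 0 ≤ ⨆ p : m × n, ‖M p.1 p.2‖ := Real.iSup_nonneg fun _ => norm_nonneg _
  refine (pi_norm_le_iff_of_nonneg h0).2 fun i => (pi_norm_le_iff_of_nonneg h0).2 fun j => ?_
  exact le_ciSup (f := fun p : m × n => ‖M p.1 p.2‖) (Set.finite_range _).bddAbove (i, j)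

/-- Quantitative linearization of the determinant: there is a constant `C`
(depending only on `n`) such that for matrices `A, B` with entries of norm at
most `1`, `‖det(1+A) - det(1+B) - tr(A-B)‖ ≤ C (a + b) e`, where `a`, `b`, `e`
are the sup-norms of the entries of `A`, `B`, `A - B` respectively. -/
theorem stmt_13 (n : ℕ) :
    ∃ C : ℝ, 0 ≤ C ∧
      ∀ A B : Matrix (Fin n) (Fin n) ℂ,
        (∀ i j, ‖A i j‖ ≤ 1) → (∀ i j, ‖B i j‖ ≤ 1) →
        ‖(1 + A).det - (1 + B).det - (A - B).trace‖ ≤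
          C * ((⨆ p : Fin n × Fin n, ‖A p.1 p.2‖) +
              (⨆ p : Fin n × Fin n, ‖B p.1 p.2‖)) *
            (⨆ p : Fin n × Fin n, ‖(A - B) p.1 p.2‖) := by
  obtain ⟨C, hC, h⟩ :=
    (Matrix.contDiff_det_one_add (n := Fin n)).exists_norm_sub_sub_fderiv_zero_le
  refine ⟨C, hC, fun A B hA hB => ?_⟩
  have norm_le_one {M : Fin n → Fin n → ℂ} (hM : ∀ i j, ‖M i j‖ ≤ 1) : ‖M‖ ≤ 1 :=
    (pi_norm_le_iff_of_nonneg zero_le_one).2 fun i =>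
      (pi_norm_le_iff_of_nonneg zero_le_one).2 (hM i)
  have hAB := h A B (norm_le_one hA) (norm_le_one hB)
  rw [Matrix.fderiv_det_one_add_zero] at hAB
  refine hAB.trans ?_
  have ha := Matrix.norm_le_iSup_norm_entry A
  have hb := Matrix.norm_le_iSup_norm_entry B
  have he := Matrix.norm_le_iSup_norm_entry (A - B)
  have hsum := add_le_add ha hb
  exact mul_le_mul (mul_le_mul_of_nonneg_left hsum hC) he (norm_nonneg _)
    (mul_nonneg hC ((add_nonneg (norm_nonneg _) (norm_nonneg _)).trans hsum))
end
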